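/- Consider the uncertain discrete-time network model under assumptions (H1), (H2), (H3), (H4). Assume the existence of a point x* ∈ S with x_i* ∈ (0,μ_i) for all i and a vector v* ∈ ℝ₊ⁿ with v_i* < min(v_i^max, min{g_i(d,0) : d ∈ D}) for all i, satisfying f_i(d,x_i*) = v_i* + Σ_{j=1}^n p_{j,i} f_j(d,x_j*) for all i and all d ∈ D. Let r ∈ ℝⁿ with r_i > 0 satisfy r_i > Σ_{j=1}^n r_j p_{i,j} for every i, and let C > 0 be a constant such that Σ_{i=1}^n r_i x_i⁺ ≤ (1−C) Σ_{i=1}^n r_i x_i + Σ_{i=1}^n r_i v_i holds for all (d,x) ∈ D × S and all v ∈ ℝ₊ⁿ with v_i ≤ v_i* for all i. Assume there exists b ∈ ℝ₊ⁿ with b ≤ v* such that r'b ≤ C min_{i=1,…,n}(r_i x_i*). Then there exist constants β_i ∈ (x_i*, μ_i] (i = 1,…,n) and a non-negative matrix K ∈ ℝ₊^{n×n} such that for every τ ∈ (0,1) the equilibrium point x* is Robustly Globally Exponentially Stable for the closed-loop system obtained from the network update with the inflow v given by the feedback law (3.3). -/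

import Mathlib

open Matrix

/-- The state set `S = [0,a₁] × ⋯ × [0,aₙ]`. -/
def stateSet {n : ℕ} (a : Fin n → ℝ) : Set (Fin n → ℝ) :=
  {x | ∀ i, x i ∈ Set.Icc 0 (a i)}

/-- The Euclidean norm of `x ∈ ℝⁿ`. -/
noncomputable def euclNorm {n : ℕ} (x : Fin n → ℝ) : ℝ :=
  Real.sqrt (∑ i, x i ^ 2)

/-- The map `h(x) = (max(0,x₁),…,max(0,xₙ))'`. -/
def posVec {n : ℕ} (x : Fin n → ℝ) : Fin n → ℝ :=
  fun i => max 0 (x i)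

/-- The general uncertain, discrete-time network model (2.9): `n` cells with
capacities `a i`, a non-empty compact disturbance set `D ⊆ ℝˡ`, demand functions
`f`, congestion functions `s`, inflow functions `w`, turning rates `p`, exit
rates `Q` and supply functions `g`, satisfying the standing modelling
assumptions, including (2.7) and (2.8). -/
structure Network (n l : ℕ) where
  /-- storage capacities -/
  a : Fin n → ℝ
  ha : ∀ i, 0 < a i
  /-- the disturbance set -/
  D : Set (Fin l → ℝ)
  hD : D.Nonempty
  hD_compact : IsCompact D
  /-- demand functions `f i : D × [0, a i] → ℝ₊` -/
  f : Fin n → (Fin l → ℝ) → ℝ → ℝ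
  /-- congestion functions `s i : D × S × ℝ₊ⁿ → [0,1]` -/
  s : Fin n → (Fin l → ℝ) → (Fin n → ℝ) → (Fin n → ℝ) → ℝ
  /-- inflow functions `w i : D × S × ℝ₊ⁿ → [0,1]` -/
  w : Fin n → (Fin l → ℝ) → (Fin n → ℝ) → (Fin n → ℝ) → ℝ
  /-- turning rates -/
  p : Fin n → Fin n → ℝ
  /-- exit rates -/
  Q : Fin n → ℝ
  /-- supply functions `g i : D × S → ℝ₊` -/
  g : Fin n → (Fin l → ℝ) → (Fin n → ℝ) → ℝ
  hf_nonneg : ∀ i, ∀ d ∈ D, ∀ z ∈ Set.Icc (0 : ℝ) (a i), 0 ≤ f i d z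
  hf_le : ∀ i, ∀ d ∈ D, ∀ z ∈ Set.Icc (0 : ℝ) (a i), f i d z ≤ z
  hs01 : ∀ i, ∀ d ∈ D, ∀ x ∈ stateSet a, ∀ v : Fin n → ℝ, (∀ j, 0 ≤ v j) →
    s i d x v ∈ Set.Icc (0 : ℝ) 1
  hw01 : ∀ i, ∀ d ∈ D, ∀ x ∈ stateSet a, ∀ v : Fin n → ℝ, (∀ j, 0 ≤ v j) →
    w i d x v ∈ Set.Icc (0 : ℝ) 1
  hp_nonneg : ∀ i j, 0 ≤ p i j
  hp_diag : ∀ i, p i i = 0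
  hQ_nonneg : ∀ i, 0 ≤ Q i
  /-- (2.5): `∑ j, p i j + Q i = 1` -/
  hpQ : ∀ i, (∑ j, p i j) + Q i = 1
  hg_cont : ∀ i, ContinuousOn (fun q : (Fin l → ℝ) × (Fin n → ℝ) => g i q.1 q.2)
    (D ×ˢ stateSet a)
  hg_nonneg : ∀ i, ∀ d ∈ D, ∀ x ∈ stateSet a, 0 ≤ g i d x
  hg_pos : ∀ i, ∀ d ∈ D, ∀ x ∈ stateSet a, x i < a i →
    0 < g i d x ∧ g i d x ≤ a i - x i
  /-- (2.7): the total inflow of each cell is bounded by its supply -/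
  h27 : ∀ i, ∀ d ∈ D, ∀ x ∈ stateSet a, ∀ v : Fin n → ℝ, (∀ j, 0 ≤ v j) →
    w i d x v * v i + ∑ j, p j i * (s j d x v * f j d (x j)) ≤ g i d x
  /-- (2.8): if every attempted total inflow can be accommodated, no congestion -/
  h28 : ∀ d ∈ D, ∀ x ∈ stateSet a, ∀ v : Fin n → ℝ, (∀ j, 0 ≤ v j) →
    (∀ i, v i + ∑ j, p j i * f j d (x j) ≤ g i d x) →
    ∀ i, w i d x v = 1 ∧ s i d x v = 1

/-- The state update map (2.9):
`x i ⁺ = x i + w i v i − s i f i (x i) + ∑ j, p j i * s j * f j (x j)`. -/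
def Network.update {n l : ℕ} (N : Network n l) (d : Fin l → ℝ)
    (x v : Fin n → ℝ) : Fin n → ℝ :=
  fun i => x i + N.w i d x v * v i - N.s i d x v * N.f i d (x i)
    + ∑ j, N.p j i * (N.s j d x v * N.f j d (x j))

/-- Assumption (H1) on the demand functions. -/
structure H1 {n l : ℕ} (N : Network n l) where
  /-- critical densities -/
  δ : Fin n → ℝ
  δt : Fin n → ℝ
  L : Fin n → ℝ
  G : Fin n → ℝ
  fmin : Fin n → ℝ
  hδ : ∀ i, δ i ∈ Set.Ioc 0 (N.a i)
  hδt : ∀ i, δt i ∈ Set.Ioc 0 (δ i)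
  hL : ∀ i, L i ∈ Set.Ioo (0 : ℝ) 1
  hG : ∀ i, G i ∈ Set.Ioc (0 : ℝ) 1
  hf_pos : ∀ i, ∀ d ∈ N.D, ∀ z ∈ Set.Ioc (0 : ℝ) (N.a i),
    0 < N.f i d z ∧ N.f i d z < z
  hf_cont : ∀ i, ∀ d ∈ N.D, ContinuousOn (N.f i d) (Set.Icc 0 (δ i))
  hf_mono : ∀ i, ∀ d ∈ N.D, StrictMonoOn (N.f i d) (Set.Icc 0 (δ i))
  hlip_low : ∀ i, ∀ d ∈ N.D, ∀ y ∈ Set.Icc (0 : ℝ) (δt i), ∀ z ∈ Set.Icc (0 : ℝ) (δt i),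
    L i * |z - y| ≤ |N.f i d z - N.f i d y|
  hlip_up : ∀ i, ∀ d ∈ N.D, ∀ y ∈ Set.Icc (0 : ℝ) (δ i), ∀ z ∈ Set.Icc (0 : ℝ) (δ i),
    |N.f i d z - N.f i d y| ≤ G i * |z - y|
  hfmin_pos : ∀ i, 0 < fmin i
  hfmin : ∀ i, ∀ d ∈ N.D, ∀ z ∈ Set.Icc (δ i) (N.a i), fmin i ≤ N.f i d z

/-- Assumption (H2): the turning-rate matrix is strictly upper triangular. -/
def Network.H2 {n l : ℕ} (N : Network n l) : Prop :=
  ∀ i j : Fin n, (j : ℕ) ≤ (i : ℕ) → N.p i j = 0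

/-- Assumption (H3): continuous positive-definite lower bounds `s̃ i` for the
congestion functions, and constants `vmax i > 0`, such that
`x i * s̃ i (d,x,v) = 0` for all `i` together with `v i < vmax i` for all `i`
imply `x = 0`. -/
structure H3 {n l : ℕ} (N : Network n l) where
  st : Fin n → (Fin l → ℝ) → (Fin n → ℝ) → (Fin n → ℝ) → ℝ
  vmax : Fin n → ℝ
  hvmax : ∀ i, 0 < vmax i
  hst_cont : ∀ i, ContinuousOn
    (fun q : (Fin l → ℝ) × (Fin n → ℝ) × (Fin n → ℝ) => st i q.1 q.2.1 q.2.2)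
    (N.D ×ˢ stateSet N.a ×ˢ {v | ∀ j, 0 ≤ v j})
  hst01 : ∀ i, ∀ d ∈ N.D, ∀ x ∈ stateSet N.a, ∀ v : Fin n → ℝ, (∀ j, 0 ≤ v j) →
    st i d x v ∈ Set.Icc (0 : ℝ) 1
  hst_le : ∀ i, ∀ d ∈ N.D, ∀ x ∈ stateSet N.a, ∀ v : Fin n → ℝ, (∀ j, 0 ≤ v j) →
    st i d x v ≤ N.s i d x v
  himp : ∀ d ∈ N.D, ∀ x ∈ stateSet N.a, ∀ v : Fin n → ℝ, (∀ j, 0 ≤ v j) →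
    (∀ i, x i * st i d x v = 0) → (∀ i, v i < vmax i) → x = 0

/-- Assumption (H4): there exist `μ i ∈ (0, δt i)` such that whenever `x ≤ μ`,
`vmax i + ∑ j, p j i * f j (x j) ≤ g i (d, x)` for every `i`. -/
structure H4 {n l : ℕ} (N : Network n l) (δt vmax : Fin n → ℝ) where
  μ : Fin n → ℝ
  hμ : ∀ i, μ i ∈ Set.Ioo (0 : ℝ) (δt i)
  hsupply : ∀ i, ∀ d ∈ N.D, ∀ x ∈ stateSet N.a, (∀ j, x j ≤ μ j) →
    vmax i + ∑ j, N.p j i * N.f j d (x j) ≤ N.g i d x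

/-- `min { g i (d, 0) : d ∈ D }` (as an infimum). -/
noncomputable def Network.gmin {n l : ℕ} (N : Network n l) (i : Fin n) : ℝ :=
  sInf ((fun d => N.g i d 0) '' N.D)

/-- The feedback law (3.3):
`v = v* − diag(v* − b) (1ₙ − h(1ₙ − τ⁻¹ K h(x − x*)))`. -/
noncomputable def feedback {n : ℕ} (vstar b : Fin n → ℝ)
    (K : Matrix (Fin n) (Fin n) ℝ) (τ : ℝ) (xstar x : Fin n → ℝ) : Fin n → ℝ :=
  fun i => vstar i - (vstar i - b i) *
    (1 - max 0 (1 - τ⁻¹ * ∑ j, K i j * max 0 (x j - xstar j)))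

/-- `x : ℕ → ℝⁿ` is a solution of the closed-loop system (2.9) with (3.3) for the
disturbance sequence `d`. -/
def IsClosedLoopSolution {n l : ℕ} (N : Network n l) (vstar b : Fin n → ℝ)
    (K : Matrix (Fin n) (Fin n) ℝ) (τ : ℝ) (xstar : Fin n → ℝ)
    (d : ℕ → Fin l → ℝ) (x : ℕ → Fin n → ℝ) : Prop :=
  ∀ t, x (t + 1) = N.update (d t) (x t) (feedback vstar b K τ xstar (x t))

/-- Finitely many positive reals have a positive lower bound. -/
theorem exists_pos_forall_le {n : ℕ} (hn : 1 ≤ n) (c : Fin n → ℝ) (hc : ∀ i, 0 < c i) :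
    ∃ m, 0 < m ∧ ∀ i, m ≤ c i := by
  have : Nonempty (Fin n) := ⟨⟨0, hn⟩⟩
  obtain ⟨i, hi⟩ := Finite.exists_min c
  exact ⟨c i, hc i, hi⟩

theorem abs_le_euclNorm {n : ℕ} (x : Fin n → ℝ) (i : Fin n) : |x i| ≤ euclNorm x :=
  Real.abs_le_sqrt <|
    Finset.single_le_sum (f := fun j => x j ^ 2) (fun j _ => sq_nonneg (x j)) (Finset.mem_univ i)

theorem euclNorm_le_sum_abs {n : ℕ} (x : Fin n → ℝ) : euclNorm x ≤ ∑ i, |x i| := by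
  refine Real.sqrt_le_iff.2 ⟨Finset.sum_nonneg fun i _ => abs_nonneg _, ?_⟩
  calc ∑ i, x i ^ 2 = ∑ i, |x i| ^ 2 := by simp only [sq_abs]
    _ ≤ (∑ i, |x i|) ^ 2 := Finset.sum_sq_le_sq_sum_of_nonneg fun i _ => abs_nonneg _

/-- The supply is bounded by the free space, also in full cells. -/
theorem Network.supply_le {n l : ℕ} (N : Network n l) (i : Fin n) {d : Fin l → ℝ} (hd : d ∈ N.D)
    {x : Fin n → ℝ} (hx : x ∈ stateSet N.a) : N.g i d x ≤ N.a i - x i := by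
  rcases (hx i).2.lt_or_eq with hlt | hxi
  · exact (N.hg_pos i d hd x hx hlt).2
  let y : ℝ → Fin n → ℝ := fun t => Function.update x i (N.a i - t)
  have hy0 : y 0 = x := by simp [y, ← hxi]
  have hyc : Continuous y := continuous_const.update i (continuous_const.sub continuous_id)
  have hyi : ∀ t, y t i = N.a i - t := fun t => by simp [y]
  have hyS : ∀ t ∈ Set.Ioo 0 (N.a i), y t ∈ stateSet N.a := by
    intro t ht j
    by_cases hj : j = i
    · subst hj
      rw [hyi]
      exact ⟨by linarith [ht.2], by linarith [ht.1]⟩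
    · simpa [y, hj] using hx j
  have hev : ∀ᶠ t in nhdsWithin (0 : ℝ) (Set.Ioi 0), t ∈ Set.Ioo 0 (N.a i) :=
    Ioo_mem_nhdsGT (N.ha i)
  have hlim : Filter.Tendsto (fun t => N.g i d (y t)) (nhdsWithin (0 : ℝ) (Set.Ioi 0))
      (nhds (N.g i d x)) := by
    have hg := N.hg_cont i (d, x) ⟨hd, hx⟩
    refine Filter.Tendsto.comp (g := fun q : (Fin l → ℝ) × (Fin n → ℝ) => N.g i q.1 q.2)
      (f := fun t => (d, y t)) hg ?_
    refine tendsto_nhdsWithin_iff.2 ⟨?_, hev.mono fun t ht => ⟨hd, hyS t ht⟩⟩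
    have h := ((continuous_const (y := d)).prodMk hyc).tendsto 0
    rw [hy0] at h
    exact h.mono_left nhdsWithin_le_nhds
  have hid : Filter.Tendsto (fun t : ℝ => t) (nhdsWithin (0 : ℝ) (Set.Ioi 0)) (nhds 0) :=
    Filter.tendsto_id.mono_left nhdsWithin_le_nhds
  have hle : N.g i d x ≤ 0 := by
    refine le_of_tendsto_of_tendsto hlim hid (hev.mono fun t ht => ?_)
    have h := (N.hg_pos i d hd (y t) (hyS t ht) (by rw [hyi]; linarith [ht.1])).2
    rw [hyi] at h
    simpa using h
  rw [hxi]
  simpa using hle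

/-- The state set is positively invariant. -/
theorem Network.update_mem {n l : ℕ} (N : Network n l) {d : Fin l → ℝ} (hd : d ∈ N.D)
    {x v : Fin n → ℝ} (hx : x ∈ stateSet N.a) (hv : ∀ i, 0 ≤ v i) :
    N.update d x v ∈ stateSet N.a := by
  intro i
  have hs := fun j => N.hs01 j d hd x hx v hv
  have hf := fun j => N.hf_nonneg j d hd (x j) (hx j)
  have hw := mul_nonneg (N.hw01 i d hd x hx v hv).1 (hv i)
  have hin : 0 ≤ ∑ j, N.p j i * (N.s j d x v * N.f j d (x j)) :=
    Finset.sum_nonneg fun j _ => mul_nonneg (N.hp_nonneg j i) (mul_nonneg (hs j).1 (hf j))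
  have hout : N.s i d x v * N.f i d (x i) ≤ x i :=
    (mul_le_of_le_one_left (hf i) (hs i).2).trans (N.hf_le i d hd (x i) (hx i))
  have hout' := mul_nonneg (hs i).1 (hf i)
  have hcap := (N.h27 i d hd x hx v hv).trans (N.supply_le i hd hx)
  simp only [Network.update, Set.mem_Icc]
  constructor <;> linarith

/-- Under (H1), a demand deviation has the sign of the density deviation `z - y` and a
comparable size. -/
theorem H1.demand_sub {n l : ℕ} {N : Network n l} (h1 : H1 N) (i : Fin n) {d : Fin l → ℝ}
    (hd : d ∈ N.D) {y z : ℝ} (hy : y ∈ Set.Icc 0 (h1.δt i)) (hz : z ∈ Set.Icc 0 (h1.δt i)) :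
    (h1.L i * (z - y) ≤ N.f i d z - N.f i d y ∧ N.f i d z - N.f i d y ≤ z - y ∧ 0 ≤ z - y ∧
        0 ≤ N.f i d z - N.f i d y) ∨
      (z - y ≤ N.f i d z - N.f i d y ∧ N.f i d z - N.f i d y ≤ h1.L i * (z - y) ∧ z - y ≤ 0 ∧
        N.f i d z - N.f i d y ≤ 0) := by
  have hsub : Set.Icc 0 (h1.δt i) ⊆ Set.Icc 0 (h1.δ i) :=
    Set.Icc_subset_Icc_right (h1.hδt i).2
  have hlo := h1.hlip_low i d hd y hy z hz
  have hup := (h1.hlip_up i d hd y (hsub hy) z (hsub hz)).trans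
    (mul_le_of_le_one_left (abs_nonneg _) (h1.hG i).2)
  rcases le_total y z with hyz | hzy
  · have hm := (h1.hf_mono i d hd).monotoneOn (hsub hy) (hsub hz) hyz
    rw [abs_of_nonneg (sub_nonneg.2 hyz), abs_of_nonneg (sub_nonneg.2 hm)] at hlo hup
    exact Or.inl ⟨hlo, hup, sub_nonneg.2 hyz, sub_nonneg.2 hm⟩
  · have hm := (h1.hf_mono i d hd).monotoneOn (hsub hz) (hsub hy) hzy
    rw [abs_of_nonpos (sub_nonpos.2 hzy), abs_of_nonpos (sub_nonpos.2 hm)] at hlo hup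
    exact Or.inr ⟨by linarith, by linarith, sub_nonpos.2 hzy, sub_nonpos.2 hm⟩

/-- A linear Lyapunov estimate for positive networks with subunitary weighted turning rates. -/
theorem weighted_sum_contraction {n : ℕ} {p : Fin n → Fin n → ℝ} {r L A B c y : Fin n → ℝ}
    {γ : ℝ} (hr : ∀ i, 0 < r i) (hrp : ∀ i, ∑ j, r j * p i j < r i)
    (hγ : ∀ i, γ * r i ≤ (r i - ∑ j, r j * p i j) * L i)
    (hA : ∀ i, 0 ≤ A i) (hLA : ∀ i, L i * A i ≤ B i)
    (hy : ∀ i, y i ≤ A i - B i + ∑ j, p j i * B j + c i) :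
    ∑ i, r i * y i ≤ (1 - γ) * ∑ i, r i * A i + ∑ i, r i * c i := by
  have hswap : ∑ i, r i * ∑ j, p j i * B j = ∑ i, (∑ j, r j * p i j) * B i := by
    simp only [Finset.mul_sum, Finset.sum_mul]
    rw [Finset.sum_comm]
    exact Finset.sum_congr rfl fun i _ => Finset.sum_congr rfl fun j _ => by ring
  calc ∑ i, r i * y i
      ≤ ∑ i, r i * (A i - B i + ∑ j, p j i * B j + c i) :=
        Finset.sum_le_sum fun i _ => mul_le_mul_of_nonneg_left (hy i) (hr i).le
    _ = ∑ i, (r i * A i - (r i - ∑ j, r j * p i j) * B i + r i * c i) := by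
        simp only [mul_add, mul_sub, sub_mul, Finset.sum_add_distrib, Finset.sum_sub_distrib,
          hswap]
        ring
    _ ≤ ∑ i, ((1 - γ) * (r i * A i) + r i * c i) := by
        refine Finset.sum_le_sum fun i _ => ?_
        have h₁ := mul_le_mul_of_nonneg_left (hLA i) (sub_nonneg.2 (hrp i).le)
        have h₂ := mul_le_mul_of_nonneg_right (hγ i) (hA i)
        nlinarith
    _ = (1 - γ) * ∑ i, r i * A i + ∑ i, r i * c i := by
        rw [Finset.sum_add_distrib, Finset.mul_sum]

/-- The weighted sum of the positive parts of the deviation of `x` from `y`. -/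
def posDev {n : ℕ} (r y x : Fin n → ℝ) : ℝ := ∑ i, r i * max 0 (x i - y i)

/-- The weighted `ℓ¹` distance of `x` from `y`. -/
def absDev {n : ℕ} (r y x : Fin n → ℝ) : ℝ := ∑ i, r i * |x i - y i|

section Dev

variable {n : ℕ} {r y x : Fin n → ℝ}

theorem posDev_nonneg (hr : ∀ i, 0 < r i) : 0 ≤ posDev r y x :=
  Finset.sum_nonneg fun i _ => mul_nonneg (hr i).le (le_max_left _ _)

theorem posDev_le_absDev (hr : ∀ i, 0 < r i) : posDev r y x ≤ absDev r y x :=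
  Finset.sum_le_sum fun i _ =>
    mul_le_mul_of_nonneg_left (max_le (abs_nonneg _) (le_abs_self _)) (hr i).le

theorem mul_sub_le_posDev (hr : ∀ i, 0 < r i) (i : Fin n) : r i * (x i - y i) ≤ posDev r y x :=
  (mul_le_mul_of_nonneg_left (le_max_right _ _) (hr i).le).trans <|
    Finset.single_le_sum (f := fun j => r j * max 0 (x j - y j))
      (fun j _ => mul_nonneg (hr j).le (le_max_left _ _)) (Finset.mem_univ i)

theorem mul_euclNorm_le_absDev {m : ℝ} (hm : 0 ≤ m) (hmr : ∀ i, m ≤ r i) :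
    m * euclNorm (x - y) ≤ absDev r y x := by
  refine (mul_le_mul_of_nonneg_left (euclNorm_le_sum_abs _) hm).trans ?_
  rw [Finset.mul_sum]
  exact Finset.sum_le_sum fun i _ => mul_le_mul_of_nonneg_right (hmr i) (abs_nonneg _)

theorem absDev_le_mul_euclNorm (hr : ∀ i, 0 < r i) :
    absDev r y x ≤ (∑ i, r i) * euclNorm (x - y) := by
  rw [Finset.sum_mul]
  exact Finset.sum_le_sum fun i _ =>
    mul_le_mul_of_nonneg_left (abs_le_euclNorm (x - y) i) (hr i).le

theorem absDev_le_of_mem {a : Fin n → ℝ} (hr : ∀ i, 0 < r i) (hx : x ∈ stateSet a)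
    (hy : y ∈ stateSet a) : absDev r y x ≤ ∑ i, r i * a i :=
  Finset.sum_le_sum fun i _ => mul_le_mul_of_nonneg_left
    (abs_sub_le_of_nonneg_of_le (hx i).1 (hx i).2 (hy i).1 (hy i).2) (hr i).le

/-- If some component of `x` exceeds that of `y`, then the weighted sum of `x` exceeds the
positive deviation by at least the smallest `r i * y i`. -/
theorem add_posDev_le (hr : ∀ i, 0 < r i) (hx : ∀ i, 0 ≤ x i) (hy : ∀ i, 0 ≤ y i) {m : ℝ}
    (hm : ∀ i, m ≤ r i * y i) (hpos : 0 < posDev r y x) :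
    m + posDev r y x ≤ ∑ i, r i * x i := by
  obtain ⟨i, -, hi⟩ := Finset.exists_lt_of_sum_lt
    (show ∑ _i : Fin n, (0 : ℝ) < posDev r y x by simpa using hpos)
  have hxy : 0 < x i - y i := by
    by_contra! h
    simp [max_eq_left h] at hi
  have hterm : ∀ j, 0 ≤ r j * x j - r j * max 0 (x j - y j) := fun j => by
    rw [← mul_sub]
    refine mul_nonneg (hr j).le (sub_nonneg.2 (max_le (hx j) ?_))
    linarith [hy j]
  have hsingle := Finset.single_le_sum
    (f := fun j => r j * x j - r j * max 0 (x j - y j)) (fun j _ => hterm j) (Finset.mem_univ i)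
  rw [Finset.sum_sub_distrib] at hsingle
  simp only [max_eq_right hxy.le] at hsingle
  unfold posDev
  linarith [hm i, mul_sub (r i) (x i) (y i)]

end Dev

section Uncongested

variable {n l : ℕ} {N : Network n l} {h1 : H1 N} {vmax : Fin n → ℝ}

/-- Below the thresholds `μ`, the network is free of congestion. -/
theorem H4.update_eq (h4 : H4 N h1.δt vmax) {d : Fin l → ℝ} (hd : d ∈ N.D) {x v : Fin n → ℝ}
    (hx : x ∈ stateSet N.a) (hxμ : ∀ i, x i ≤ h4.μ i) (hv : ∀ i, 0 ≤ v i)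
    (hvmax : ∀ i, v i ≤ vmax i) (i : Fin n) :
    N.update d x v i = x i + v i - N.f i d (x i) + ∑ j, N.p j i * N.f j d (x j) := by
  have h := N.h28 d hd x hx v hv fun i => by linarith [h4.hsupply i d hd x hx hxμ, hvmax i]
  simp [Network.update, h]

variable (h4 : H4 N h1.δt vmax) {d : Fin l → ℝ} {xstar vstar x v r : Fin n → ℝ} {γ : ℝ}

/-- One step of the uncongested network: the deviation from the equilibrium. -/
theorem H4.update_sub_eq (hd : d ∈ N.D)
    (heq : ∀ i, N.f i d (xstar i) = vstar i + ∑ j, N.p j i * N.f j d (xstar j))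
    (hvstar : ∀ i, vstar i ≤ vmax i)
    (hx : x ∈ stateSet N.a) (hxμ : ∀ i, x i ≤ h4.μ i) (hv : ∀ i, 0 ≤ v i ∧ v i ≤ vstar i)
    (i : Fin n) :
    N.update d x v i - xstar i = (x i - xstar i) - (N.f i d (x i) - N.f i d (xstar i)) +
      ∑ j, N.p j i * (N.f j d (x j) - N.f j d (xstar j)) + (v i - vstar i) := by
  rw [h4.update_eq hd hx hxμ (fun i => (hv i).1) (fun i => (hv i).2.trans (hvstar i))]
  simp only [mul_sub, Finset.sum_sub_distrib]
  linarith [heq i]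

theorem H4.demand_sub (hxstar : ∀ i, xstar i ∈ Set.Ioo 0 (h4.μ i)) (hd : d ∈ N.D)
    (hx : x ∈ stateSet N.a) (hxμ : ∀ i, x i ≤ h4.μ i) (i : Fin n) :
    (h1.L i * (x i - xstar i) ≤ N.f i d (x i) - N.f i d (xstar i) ∧
        N.f i d (x i) - N.f i d (xstar i) ≤ x i - xstar i ∧ 0 ≤ x i - xstar i ∧
        0 ≤ N.f i d (x i) - N.f i d (xstar i)) ∨
      (x i - xstar i ≤ N.f i d (x i) - N.f i d (xstar i) ∧
        N.f i d (x i) - N.f i d (xstar i) ≤ h1.L i * (x i - xstar i) ∧ x i - xstar i ≤ 0 ∧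
        N.f i d (x i) - N.f i d (xstar i) ≤ 0) :=
  h1.demand_sub i hd ⟨(hxstar i).1.le, (hxstar i).2.le.trans (h4.hμ i).2.le⟩
    ⟨(hx i).1, (hxμ i).trans (h4.hμ i).2.le⟩

/-- Below the thresholds, the positive deviation contracts. -/
theorem H4.posDev_update_le (hxstar : ∀ i, xstar i ∈ Set.Ioo 0 (h4.μ i)) (hd : d ∈ N.D)
    (heq : ∀ i, N.f i d (xstar i) = vstar i + ∑ j, N.p j i * N.f j d (xstar j))
    (hvstar : ∀ i, vstar i ≤ vmax i)
    (hr : ∀ i, 0 < r i) (hrp : ∀ i, ∑ j, r j * N.p i j < r i)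
    (hγ : ∀ i, γ * r i ≤ (r i - ∑ j, r j * N.p i j) * h1.L i)
    (hx : x ∈ stateSet N.a) (hxμ : ∀ i, x i ≤ h4.μ i) (hv : ∀ i, 0 ≤ v i ∧ v i ≤ vstar i) :
    posDev r xstar (N.update d x v) ≤ (1 - γ) * posDev r xstar x := by
  have hφ := h4.demand_sub hxstar hd hx hxμ
  have h := weighted_sum_contraction (p := N.p) (L := h1.L)
    (A := fun i => max 0 (x i - xstar i))
    (B := fun i => max 0 (N.f i d (x i) - N.f i d (xstar i))) (c := fun _ => 0)
    (y := fun i => max 0 (N.update d x v i - xstar i)) hr hrp hγ (fun i => le_max_left _ _)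
    (fun i => ?_) (fun i => ?_)
  · simpa [posDev] using h
  · rcases hφ i with ⟨h₁, -, h₃, h₄⟩ | ⟨-, -, h₃, h₄⟩
    · simpa only [max_eq_right h₃, max_eq_right h₄] using h₁
    · simp [max_eq_left h₃, max_eq_left h₄]
  · rw [h4.update_sub_eq hd heq hvstar hx hxμ hv]
    have hsum : ∑ j, N.p j i * (N.f j d (x j) - N.f j d (xstar j)) ≤
        ∑ j, N.p j i * max 0 (N.f j d (x j) - N.f j d (xstar j)) :=
      Finset.sum_le_sum fun j _ => mul_le_mul_of_nonneg_left (le_max_right _ _) (N.hp_nonneg j i)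
    have hsum' : 0 ≤ ∑ j, N.p j i * max 0 (N.f j d (x j) - N.f j d (xstar j)) :=
      Finset.sum_nonneg fun j _ => mul_nonneg (N.hp_nonneg j i) (le_max_left _ _)
    have hvi := (hv i).2
    rcases hφ i with ⟨-, h₂, h₃, h₄⟩ | ⟨h₁, -, h₃, h₄⟩
    · simp only [max_eq_right h₃, max_eq_right h₄]
      exact max_le (by linarith) (by linarith)
    · simp only [max_eq_left h₃, max_eq_left h₄]
      exact max_le (by linarith) (by linarith)

/-- Below the thresholds, the deviation contracts up to the size of the input deviation. -/
theorem H4.absDev_update_le (hxstar : ∀ i, xstar i ∈ Set.Ioo 0 (h4.μ i)) (hd : d ∈ N.D)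
    (heq : ∀ i, N.f i d (xstar i) = vstar i + ∑ j, N.p j i * N.f j d (xstar j))
    (hvstar : ∀ i, vstar i ≤ vmax i)
    (hr : ∀ i, 0 < r i) (hrp : ∀ i, ∑ j, r j * N.p i j < r i)
    (hγ : ∀ i, γ * r i ≤ (r i - ∑ j, r j * N.p i j) * h1.L i)
    (hx : x ∈ stateSet N.a) (hxμ : ∀ i, x i ≤ h4.μ i) (hv : ∀ i, 0 ≤ v i ∧ v i ≤ vstar i) :
    absDev r xstar (N.update d x v) ≤
      (1 - γ) * absDev r xstar x + ∑ i, r i * (vstar i - v i) := by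
  have hφ := h4.demand_sub hxstar hd hx hxμ
  refine weighted_sum_contraction (p := N.p) (L := h1.L) (A := fun i => |x i - xstar i|)
    (B := fun i => |N.f i d (x i) - N.f i d (xstar i)|) (c := fun i => vstar i - v i)
    (y := fun i => |N.update d x v i - xstar i|) hr hrp hγ (fun i => abs_nonneg _)
    (fun i => ?_) (fun i => ?_)
  · rcases hφ i with ⟨h₁, -, h₃, h₄⟩ | ⟨-, h₂, h₃, h₄⟩
    · simpa only [abs_of_nonneg h₃, abs_of_nonneg h₄] using h₁
    · simp only [abs_of_nonpos h₃, abs_of_nonpos h₄]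
      linarith
  · rw [h4.update_sub_eq hd heq hvstar hx hxμ hv]
    have hsum : |∑ j, N.p j i * (N.f j d (x j) - N.f j d (xstar j))| ≤
        ∑ j, N.p j i * |N.f j d (x j) - N.f j d (xstar j)| := by
      refine (Finset.abs_sum_le_sum_abs _ _).trans_eq (Finset.sum_congr rfl fun j _ => ?_)
      rw [abs_mul, abs_of_nonneg (N.hp_nonneg j i)]
    obtain ⟨hs₁, hs₂⟩ := abs_le.1 hsum
    have hvi := (hv i).2
    rcases hφ i with ⟨-, h₂, h₃, h₄⟩ | ⟨h₁, -, h₃, h₄⟩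
    · simp only [abs_of_nonneg h₃, abs_of_nonneg h₄]
      exact abs_le.2 ⟨by linarith, by linarith⟩
    · simp only [abs_of_nonpos h₃, abs_of_nonpos h₄]
      exact abs_le.2 ⟨by linarith, by linarith⟩

end Uncongested

section Feedback

variable {n : ℕ} {vstar b r : Fin n → ℝ} {w τ : ℝ} {xstar x : Fin n → ℝ}

theorem feedback_mem {K : Matrix (Fin n) (Fin n) ℝ} (hK : ∀ i j, 0 ≤ K i j) (hτ : 0 < τ)
    (hb : ∀ i, b i ≤ vstar i) (i : Fin n) :
    b i ≤ feedback vstar b K τ xstar x i ∧ feedback vstar b K τ xstar x i ≤ vstar i := by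
  have hq : 0 ≤ τ⁻¹ * ∑ j, K i j * max 0 (x j - xstar j) :=
    mul_nonneg (inv_nonneg.2 hτ.le) <|
      Finset.sum_nonneg fun j _ => mul_nonneg (hK i j) (le_max_left _ _)
  have h₁ := mul_nonneg (sub_nonneg.2 (hb i))
    (le_max_left 0 (1 - τ⁻¹ * ∑ j, K i j * max 0 (x j - xstar j)))
  have h₂ := mul_nonneg (sub_nonneg.2 (hb i)) (sub_nonneg.2
    (max_le zero_le_one (sub_le_self 1 hq)))
  simp only [feedback]
  constructor <;> linarith

theorem sum_gain_eq (i : Fin n) :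
    ∑ j, (Matrix.of fun _ j => r j / w : Matrix (Fin n) (Fin n) ℝ) i j * max 0 (x j - xstar j) =
      posDev r xstar x / w := by
  simp only [Matrix.of_apply, posDev, Finset.sum_div]
  exact Finset.sum_congr rfl fun j _ => by ring

theorem feedback_eq_of_lt_posDev (hw : 0 < w) (hτ : τ ∈ Set.Ioo (0 : ℝ) 1)
    (hx : w < posDev r xstar x) :
    feedback vstar b (Matrix.of fun _ j => r j / w) τ xstar x = b := by
  funext i
  have hq : 1 ≤ τ⁻¹ * (posDev r xstar x / w) :=
    one_le_mul_of_one_le_of_one_le (one_le_inv_iff₀.2 ⟨hτ.1, hτ.2.le⟩) ((one_le_div hw).2 hx.le)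
  simp only [feedback, sum_gain_eq, max_eq_left (sub_nonpos.2 hq)]
  ring

theorem sub_feedback_le (hb : ∀ i, b i ≤ vstar i) (i : Fin n) :
    vstar i - feedback vstar b (Matrix.of fun _ j => r j / w) τ xstar x i ≤
      (vstar i - b i) * (τ⁻¹ * (posDev r xstar x / w)) := by
  simp only [feedback, sum_gain_eq, sub_sub_cancel]
  refine mul_le_mul_of_nonneg_left ?_ (sub_nonneg.2 (hb i))
  linarith [le_max_right 0 (1 - τ⁻¹ * (posDev r xstar x / w))]

end Feedback

/-- **Theorem 3.7.** Under (H1), (H2), (H3), (H4), assume the existence of an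
uncongested equilibrium point `x*` with `x* i ∈ (0, μ i)` and
`v* i ∈ [0, min(vmax i, min{g i (d,0) : d ∈ D}))` satisfying (3.1). Let `r i > 0`
with `r i > ∑ j, r j * p i j` and let `C > 0` satisfy the contraction estimate
(2.14) for all `v` with `0 ≤ v ≤ v*`. Assume there exists `b ∈ ℝ₊ⁿ` with `b ≤ v*`
such that `r'b ≤ C min_i (r i * x* i)`. Then there exist constants
`β i ∈ (x* i, μ i]` and a non-negative matrix `K` such that for every `τ ∈ (0,1)`
the equilibrium `x*` is Robustly Globally Exponentially Stable for the
closed-loop system (2.9) with (3.3): there exist `M, σ > 0` such that every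
solution with initial condition in `S` and any disturbance sequence in `D`
satisfies `|x(t) − x*| ≤ M exp(−σ t) |x(0) − x*|` for all `t`. -/
theorem stmt12 {n l : ℕ} (hn : 1 ≤ n) (N : Network n l)
    (h1 : H1 N) (h2 : N.H2) (h3 : H3 N) (h4 : H4 N h1.δt h3.vmax)
    (xstar vstar : Fin n → ℝ)
    (hxstar : ∀ i, xstar i ∈ Set.Ioo 0 (h4.μ i))
    (hvstar_nonneg : ∀ i, 0 ≤ vstar i)
    (hvstar : ∀ i, vstar i < min (h3.vmax i) (N.gmin i))
    (heq : ∀ d ∈ N.D, ∀ i,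
      N.f i d (xstar i) = vstar i + ∑ j, N.p j i * N.f j d (xstar j))
    (r : Fin n → ℝ) (hr : ∀ i, 0 < r i)
    (hr' : ∀ i, ∑ j, r j * N.p i j < r i)
    (C : ℝ) (hC : 0 < C)
    (hC' : ∀ d ∈ N.D, ∀ x ∈ stateSet N.a, ∀ v : Fin n → ℝ,
      (∀ i, 0 ≤ v i ∧ v i ≤ vstar i) →
      ∑ i, r i * N.update d x v i ≤
        (1 - C) * ∑ i, r i * x i + ∑ i, r i * v i)
    (b : Fin n → ℝ) (hb_nonneg : ∀ i, 0 ≤ b i) (hb : ∀ i, b i ≤ vstar i)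
    (hrb : ∀ i, ∑ j, r j * b j ≤ C * (r i * xstar i)) :
    ∃ β : Fin n → ℝ, (∀ i, β i ∈ Set.Ioc (xstar i) (h4.μ i)) ∧
      ∃ K : Matrix (Fin n) (Fin n) ℝ, (∀ i j, 0 ≤ K i j) ∧
      ∀ τ ∈ Set.Ioo (0 : ℝ) 1,
      ∃ M σ : ℝ, 0 < M ∧ 0 < σ ∧
        ∀ d : ℕ → Fin l → ℝ, (∀ t, d t ∈ N.D) →
        ∀ x : ℕ → Fin n → ℝ, x 0 ∈ stateSet N.a →
        IsClosedLoopSolution N vstar b K τ xstar d x →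
        ∀ t : ℕ, euclNorm (x t - xstar) ≤
          M * Real.exp (-σ * t) * euclNorm (x 0 - xstar) := by
  obtain ⟨w, hw, hwμ⟩ := exists_pos_forall_le hn (fun i => r i * (h4.μ i - xstar i))
    fun i => mul_pos (hr i) (sub_pos.2 (hxstar i).2)
  refine ⟨h4.μ, fun i => ⟨(hxstar i).2, le_rfl⟩, Matrix.of fun _ j => r j / w,
    fun i j => (div_pos (hr j) hw).le, fun τ hτ => ?_⟩
  obtain ⟨γ, hγ, hγr⟩ := exists_pos_forall_le hn
    (fun i => (r i - ∑ j, r j * N.p i j) * h1.L i / r i)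
    fun i => div_pos (mul_pos (sub_pos.2 (hr' i)) (h1.hL i).1) (hr i)
  replace hγr : ∀ i, γ * r i ≤ (r i - ∑ j, r j * N.p i j) * h1.L i :=
    fun i => (le_div_iff₀ (hr i)).1 (hγr i)
  obtain ⟨m, hm, hmr⟩ := exists_pos_forall_le hn r hr
  have hxstarS : xstar ∈ stateSet N.a := fun i => ⟨(hxstar i).1.le,
    (hxstar i).2.le.trans ((h4.hμ i).2.le.trans ((h1.hδt i).2.trans (h1.hδ i).2))⟩
  have hvmax : ∀ i, vstar i ≤ h3.vmax i := fun i => ((hvstar i).trans_le (min_le_left _ _)).le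
  let B : ℝ := (∑ i, r i * (vstar i - b i)) * (τ⁻¹ / w)
  have hB : 0 ≤ B := mul_nonneg
    (Finset.sum_nonneg fun i _ => mul_nonneg (hr i).le (sub_nonneg.2 (hb i)))
    (div_nonneg (inv_nonneg.2 hτ.1.le) hw.le)
  let A : ℝ := 2 * B / γ
  have hA : 0 ≤ A := by positivity
  have hAγ : A * γ = 2 * B := div_mul_cancel₀ _ hγ.ne'
  let R : ℝ := ∑ i, r i * N.a i
  have : Nonempty (Fin n) := ⟨⟨0, hn⟩⟩
  have hR : 0 < R := Finset.sum_pos (fun i _ => mul_pos (hr i) (N.ha i)) Finset.univ_nonempty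
  let U : (Fin n → ℝ) → ℝ := fun x => absDev r xstar x + A * posDev r xstar x
  let V : (Fin n → ℝ) → ℝ := fun x => ∑ i, r i * x i
  let κ : ℝ := γ / 2 / (C * w)
  have hκ : 0 < κ := by positivity
  have hκC : κ * (C * w) = γ / 2 := div_mul_cancel₀ _ (mul_pos hC hw).ne'
  let Φ : (Fin n → ℝ) → ℝ := fun x =>
    if posDev r xstar x ≤ w then U x else (1 + A) * R * Real.exp (κ * V x)
  have hV0 : ∀ x ∈ stateSet N.a, 0 ≤ V x := fun x hx =>
    Finset.sum_nonneg fun i _ => mul_nonneg (hr i).le (hx i).1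
  have hVR : ∀ x ∈ stateSet N.a, V x ≤ R := fun x hx =>
    Finset.sum_le_sum fun i _ => mul_le_mul_of_nonneg_left (hx i).2 (hr i).le
  have hUabs : ∀ x, U x ≤ (1 + A) * absDev r xstar x := fun x => by
    have := mul_le_mul_of_nonneg_left (posDev_le_absDev (y := xstar) (x := x) hr) hA
    simp only [U]
    linarith
  have habsU : ∀ x, absDev r xstar x ≤ U x := fun x =>
    le_add_of_nonneg_right (mul_nonneg hA (posDev_nonneg hr))
  have hUR : ∀ x ∈ stateSet N.a, U x ≤ (1 + A) * R := fun x hx =>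
    (hUabs x).trans (mul_le_mul_of_nonneg_left (absDev_le_of_mem hr hx hxstarS) (by linarith))
  have hUΦ : ∀ x ∈ stateSet N.a, U x ≤ Φ x := fun x hx => by
    simp only [Φ]
    split_ifs
    · exact le_rfl
    · exact (hUR x hx).trans (le_mul_of_one_le_right (by positivity)
        (Real.one_le_exp (mul_nonneg hκ.le (hV0 x hx))))
  let M₀ : ℝ := 1 + (1 + A) * R * Real.exp (κ * R) / w
  have hM₀ : 0 < M₀ := by positivity
  have hΦU : ∀ x ∈ stateSet N.a, Φ x ≤ M₀ * U x := fun x hx => by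
    have hU0 : 0 ≤ U x := ((posDev_nonneg hr).trans (posDev_le_absDev hr)).trans (habsU x)
    simp only [Φ]
    split_ifs with h
    · exact le_mul_of_one_le_left hU0 (le_add_of_nonneg_right (by positivity))
    · have hwU : w ≤ U x := (not_le.1 h).le.trans ((posDev_le_absDev hr).trans (habsU x))
      calc (1 + A) * R * Real.exp (κ * V x)
          ≤ (1 + A) * R * Real.exp (κ * R) := by
            gcongr
            exact hVR x hx
        _ = (1 + A) * R * Real.exp (κ * R) / w * w := (div_mul_cancel₀ _ hw.ne').symm
        _ ≤ (1 + A) * R * Real.exp (κ * R) / w * U x := by gcongr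
        _ ≤ M₀ * U x := by
            simp only [M₀]
            linarith
  let u : (Fin n → ℝ) → Fin n → ℝ := feedback vstar b (Matrix.of fun _ j => r j / w) τ xstar
  have hu : ∀ x i, b i ≤ u x i ∧ u x i ≤ vstar i := fun x =>
    feedback_mem (fun i j => (div_pos (hr j) hw).le) hτ.1 hb
  have hu' : ∀ x i, 0 ≤ u x i ∧ u x i ≤ vstar i := fun x i =>
    ⟨(hb_nonneg i).trans (hu x i).1, (hu x i).2⟩
  have hstep : ∀ d ∈ N.D, ∀ x ∈ stateSet N.a,
      Φ (N.update d x (u x)) ≤ Real.exp (-(γ / 2)) * Φ x := by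
    intro d hd x hx
    have hxS : N.update d x (u x) ∈ stateSet N.a := N.update_mem hd hx fun i => (hu' x i).1
    by_cases h : posDev r xstar x ≤ w
    · have hxμ : ∀ i, x i ≤ h4.μ i := fun i => by
        have := (mul_sub_le_posDev (x := x) (y := xstar) hr i).trans (h.trans (hwμ i))
        linarith [le_of_mul_le_mul_left this (hr i)]
      have hpos := h4.posDev_update_le hxstar hd (heq d hd) hvmax hr hr' hγr hx hxμ (hu' x)
      have habs := h4.absDev_update_le hxstar hd (heq d hd) hvmax hr hr' hγr hx hxμ (hu' x)
      have hin : ∑ i, r i * (vstar i - u x i) ≤ B * posDev r xstar x := by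
        calc ∑ i, r i * (vstar i - u x i)
            ≤ ∑ i, r i * ((vstar i - b i) * (τ⁻¹ * (posDev r xstar x / w))) :=
              Finset.sum_le_sum fun i _ =>
                mul_le_mul_of_nonneg_left (sub_feedback_le hb i) (hr i).le
          _ = B * posDev r xstar x := by
              simp only [B, Finset.sum_mul]
              exact Finset.sum_congr rfl fun i _ => by ring
      have hP0 : 0 ≤ posDev r xstar x := posDev_nonneg hr
      have hin' : posDev r xstar (N.update d x (u x)) ≤ w :=
        hpos.trans ((mul_le_of_le_one_left hP0 (by linarith)).trans h)
      have hU0 : 0 ≤ U x := (hP0.trans (posDev_le_absDev hr)).trans (habsU x)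
      have habs0 : 0 ≤ absDev r xstar x := hP0.trans (posDev_le_absDev hr)
      have hexp : 1 - γ / 2 ≤ Real.exp (-(γ / 2)) := by
        linarith [Real.add_one_le_exp (-(γ / 2))]
      simp only [Φ, if_pos h, if_pos hin']
      refine le_trans ?_ (mul_le_mul_of_nonneg_right hexp hU0)
      have hApos := mul_le_mul_of_nonneg_left hpos hA
      have hγabs := mul_nonneg hγ.le habs0
      have hAγP : A * γ * posDev r xstar x = 2 * B * posDev r xstar x := by rw [hAγ]
      simp only [U]
      nlinarith
    · have hlt : w < posDev r xstar x := not_le.1 h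
      have hub : u x = b := feedback_eq_of_lt_posDev hw hτ hlt
      have hdec := hC' d hd x hx (u x) (hu' x)
      have hlow := add_posDev_le (m := (∑ j, r j * b j) / C) hr (fun i => (hx i).1)
        (fun i => (hxstarS i).1) (fun i => (div_le_iff₀' hC).2 (hrb i)) (hw.trans hlt)
      have hVdec : V (N.update d x (u x)) ≤ V x - C * w := by
        have h₁ := mul_le_mul_of_nonneg_left hlow hC.le
        rw [mul_add, mul_div_cancel₀ _ hC.ne'] at h₁
        have h₂ := mul_le_mul_of_nonneg_left hlt.le hC.le
        rw [hub] at hdec ⊢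
        simp only [V]
        linarith
      have hκV : κ * V (N.update d x (u x)) ≤ -(γ / 2) + κ * V x := by
        have := mul_le_mul_of_nonneg_left hVdec hκ.le
        rw [mul_sub, hκC] at this
        linarith
      have hkey : (1 + A) * R * Real.exp (κ * V (N.update d x (u x))) ≤
          Real.exp (-(γ / 2)) * ((1 + A) * R * Real.exp (κ * V x)) := by
        rw [mul_left_comm, ← Real.exp_add]
        gcongr
      refine le_trans ?_ (hkey.trans_eq (by simp only [Φ, if_neg h]))
      simp only [Φ]
      split_ifs
      · exact (hUR _ hxS).trans (le_mul_of_one_le_right (by positivity)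
          (Real.one_le_exp (mul_nonneg hκ.le (hV0 _ hxS))))
      · exact le_rfl
  have hrsum : 0 < ∑ i, r i := Finset.sum_pos (fun i _ => hr i) Finset.univ_nonempty
  refine ⟨M₀ * ((1 + A) * ∑ i, r i) / m, γ / 2, by positivity, by positivity, ?_⟩
  intro d hd x hx0 hsol t
  have hmem : ∀ t, x t ∈ stateSet N.a := fun t => by
    induction t with
    | zero => exact hx0
    | succ t ih =>
      rw [hsol t]
      exact N.update_mem (hd t) ih fun i => (hu' (x t) i).1
  have hΦt : Φ (x t) ≤ Real.exp (-(γ / 2) * t) * Φ (x 0) := by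
    induction t with
    | zero => simp
    | succ t ih =>
      rw [hsol t]
      refine (hstep (d t) (hd t) (x t) (hmem t)).trans
        ((mul_le_mul_of_nonneg_left ih (Real.exp_pos _).le).trans_eq ?_)
      rw [← mul_assoc, ← Real.exp_add]
      push_cast
      ring_nf
  have hfin : m * euclNorm (x t - xstar) ≤
      Real.exp (-(γ / 2) * t) * (M₀ * ((1 + A) * ((∑ i, r i) * euclNorm (x 0 - xstar)))) := by
    refine (mul_euclNorm_le_absDev hm.le hmr).trans ((habsU _).trans
      ((hUΦ _ (hmem t)).trans (hΦt.trans ?_)))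
    gcongr
    refine (hΦU _ hx0).trans (mul_le_mul_of_nonneg_left ((hUabs _).trans ?_) hM₀.le)
    exact mul_le_mul_of_nonneg_left (absDev_le_mul_euclNorm hr) (by linarith)
  rw [← le_div_iff₀' hm] at hfin
  exact hfin.trans_eq (by ring)
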